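/- Let d ≥ 1. For each k ∈ {1,…,d}, let f_k : ℝ^{k-1} × ℝ → ℝ be jointly continuous, strictly increasing in its last argument, and surjective onto ℝ in its last argument for each fixed first argument. Let ν_1,…,ν_d be probability measures on ℝ, each with a positive continuous density. Define T : ℝ^d → ℝ^d recursively by T(u)_k = f_k(T(u)_1,…,T(u)_{k-1}, u_k). Then T is a continuous lower triangular monotone map, and it is the unique such transport map to its image law: if S : ℝ^d → ℝ^d is any continuous lower triangular monotone map such that the pushforward of the product measure ν_1 ⊗ ⋯ ⊗ ν_d under S equals its pushforward under T, then S = T everywhere on ℝ^d. -/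

import Mathlib

open MeasureTheory

/-- A map `S : ℝ^d → ℝ^d` is lower triangular if each component `S_k` depends only on the
coordinates `x_1, …, x_k`. -/
def LowerTriangular (d : ℕ) (S : (Fin d → ℝ) → Fin d → ℝ) : Prop :=
  ∀ k : Fin d, ∀ x y : Fin d → ℝ, (∀ i ≤ k, x i = y i) → S x k = S y k

/-- A map `S : ℝ^d → ℝ^d` is monotone (in the triangular sense) if for each `k` and each fixed
`x_1, …, x_{k-1}`, the map `t ↦ S_k(x_1,…,x_{k-1},t)` is strictly increasing. -/
def MonotoneLast (d : ℕ) (S : (Fin d → ℝ) → Fin d → ℝ) : Prop :=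
  ∀ (k : Fin d) (x : Fin d → ℝ), StrictMono fun t => S (Function.update x k t) k

theorem tri_inj {d : ℕ} {T : (Fin d → ℝ) → Fin d → ℝ} (h1 : LowerTriangular d T)
    (h2 : MonotoneLast d T) (k : Fin d) (x u : Fin d → ℝ) (h : ∀ i < k, T x i = T u i) :
    ∀ i < k, x i = u i := by
  intro i
  induction i using WellFoundedLT.induction with
  | ind i ih =>
    intro hi
    have e : T u i = T (Function.update x i (u i)) i := by
      apply h1
      intro j hj
      rcases hj.lt_or_eq with hj | rfl
      · rw [Function.update_of_ne hj.ne]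
        exact (ih j hj (hj.trans hi)).symm
      · simp
    have e2 : T x i = T (Function.update x i (x i)) i := by simp
    apply (h2 i x).injective
    show T (Function.update x i (x i)) i = T (Function.update x i (u i)) i
    rw [← e, ← e2, h i hi]

theorem tri_le {d : ℕ} {S T : (Fin d → ℝ) → Fin d → ℝ} (μ : Measure (Fin d → ℝ))
    [IsFiniteMeasure μ] [μ.IsOpenPosMeasure]
    (hS : Continuous S) (hT : Continuous T)
    (S1 : LowerTriangular d S) (S2 : MonotoneLast d S)
    (T1 : LowerTriangular d T) (T2 : MonotoneLast d T)
    (hm : μ.map S = μ.map T) (k : Fin d) (hk : ∀ i < k, ∀ x, S x i = T x i) (x0 : Fin d → ℝ) :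
    S x0 k ≤ T x0 k := by
  by_contra! hlt
  obtain ⟨c, hc1, hc2⟩ := exists_between hlt
  have hev : ∀ᶠ x in nhds x0, T x k < c ∧ c < S x k := by
    have a : Continuous fun x => T x k := (continuous_apply k).comp hT
    have b : Continuous fun x => S x k := (continuous_apply k).comp hS
    exact (a.continuousAt.eventually_lt continuousAt_const hc1).and
      (continuousAt_const.eventually_lt b.continuousAt hc2)
  obtain ⟨ε, hε, hball⟩ := Metric.nhds_basis_closedBall.eventually_iff.1 hev
  set K := Metric.closedBall x0 ε with hK
  have hKc : IsCompact K := isCompact_closedBall x0 ε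
  let r : (Fin d → ℝ) → ({i : Fin d // i < k} → ℝ) := fun y i => y i
  have hr : Continuous r := by fun_prop
  let A : Set (Fin d → ℝ) := r ⁻¹' ((r ∘ T) '' K)
  have hA : IsClosed A := (hKc.image (hr.comp hT)).isClosed.preimage hr
  let B : Set (Fin d → ℝ) := A ∩ {y | y k ≤ c}
  have hB : IsClosed B := hA.inter (isClosed_le (continuous_apply k) continuous_const)
  have hsub : S ⁻¹' B ⊆ T ⁻¹' B := by
    rintro x ⟨⟨u, hu, hux⟩, hxc⟩
    have hTx : ∀ i < k, T x i = T u i := by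
      intro i hi
      have := congrFun hux ⟨i, hi⟩
      rw [← hk i hi x]
      exact this.symm
    have hxu := tri_inj T1 T2 k x u hTx
    set x' := Function.update x k (x0 k) with hx'
    set u' := Function.update u k (x0 k) with hu'
    have hu'K : u' ∈ K := by
      rw [hK, Metric.mem_closedBall, dist_pi_le_iff hε.le] at hu ⊢
      intro i
      by_cases hi : i = k
      · subst hi; simp [hu', hε.le]
      · rw [hu', Function.update_of_ne hi]; exact hu i
    have hag : ∀ i ≤ k, x' i = u' i := by
      intro i hi
      rcases hi.lt_or_eq with hi | rfl
      · rw [hx', hu', Function.update_of_ne hi.ne, Function.update_of_ne hi.ne, hxu i hi]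
      · simp [hx', hu']
    have hb := hball hu'K
    rw [← S1 k x' u' hag, ← T1 k x' u' hag] at hb
    have hxx : x = Function.update x k (x k) := by simp
    have hxk : x k < x0 k := by
      by_contra! hge
      have h := (S2 k x).monotone hge
      simp only [← hxx, ← hx'] at h
      exact absurd (hb.2.trans_le h) (not_lt.2 hxc)
    have hlt := S2 k x hxk
    have hlt2 := T2 k x hxk
    simp only [← hxx, ← hx'] at hlt2
    refine ⟨⟨u, hu, ?_⟩, (hlt2.trans hb.1).le⟩
    funext i
    exact (hTx i i.2).symm
  have hmeas : μ (S ⁻¹' B) = μ (T ⁻¹' B) := by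
    rw [← Measure.map_apply hS.measurable hB.measurableSet, hm,
      Measure.map_apply hT.measurable hB.measurableSet]
  have hdiff : μ (T ⁻¹' B \ S ⁻¹' B) = 0 := by
    rw [measure_sdiff hsub (hS.measurable hB.measurableSet).nullMeasurableSet
      (measure_ne_top _ _), hmeas, tsub_self]
  have hsub2 : Metric.ball x0 ε ⊆ T ⁻¹' B \ S ⁻¹' B := by
    intro x hx
    have hx := Metric.ball_subset_closedBall hx
    have hb := hball hx
    exact ⟨⟨⟨x, hx, rfl⟩, hb.1.le⟩, fun h => absurd hb.2 (not_lt.2 h.2)⟩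
  exact (Metric.measure_ball_pos μ x0 hε).ne' (measure_mono_null hsub2 hdiff)

/-- The structural map `T` of a SEM (in the identity ordering), defined recursively by
`T(u)_k = f_k(T(u)_1, …, T(u)_{k-1}, u_k)` with each `f_k` jointly continuous, strictly
increasing and surjective in its last argument, is a continuous lower triangular monotone map,
and it is the unique continuous lower triangular monotone map pushing the product noise
distribution `ν_1 ⊗ ⋯ ⊗ ν_d` forward to its image law. -/
theorem stmt6 (d : ℕ) (hd : 1 ≤ d)
    (f : (k : Fin d) → (Fin k.1 → ℝ) → ℝ → ℝ)
    (hfc : ∀ k : Fin d, Continuous fun p : (Fin k.1 → ℝ) × ℝ => f k p.1 p.2)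
    (hfm : ∀ (k : Fin d) (v : Fin k.1 → ℝ), StrictMono (f k v))
    (hfs : ∀ (k : Fin d) (v : Fin k.1 → ℝ), Function.Surjective (f k v))
    (ν : Fin d → Measure ℝ) [∀ k, IsProbabilityMeasure (ν k)]
    (hν : ∀ k, ∃ p : ℝ → ℝ, Continuous p ∧ (∀ x, 0 < p x) ∧
      ν k = volume.withDensity fun x => ENNReal.ofReal (p x))
    (T : (Fin d → ℝ) → Fin d → ℝ)
    (hT : ∀ (u : Fin d → ℝ) (k : Fin d),
      T u k = f k (fun i : Fin k.1 => T u ⟨i.1, lt_trans i.isLt k.isLt⟩) (u k)) :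
    Continuous T ∧ LowerTriangular d T ∧ MonotoneLast d T ∧
      ∀ S : (Fin d → ℝ) → Fin d → ℝ,
        Continuous S → LowerTriangular d S → MonotoneLast d S →
        (Measure.pi ν).map S = (Measure.pi ν).map T → S = T := by
  have hc : ∀ k, Continuous fun u => T u k := by
    intro k
    induction k using WellFoundedLT.induction with
    | ind k ih =>
      have e : (fun u => T u k) = fun u =>
        f k (fun i : Fin k.1 => T u ⟨i.1, lt_trans i.isLt k.isLt⟩) (u k) := by
        funext u; exact hT u k
      rw [e]
      exact (hfc k).comp (Continuous.prodMk (continuous_pi fun i => ih _ i.isLt)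
        (continuous_apply k))
  have hTc : Continuous T := continuous_pi hc
  have T1 : LowerTriangular d T := by
    intro k
    induction k using WellFoundedLT.induction with
    | ind k ih =>
      intro x y h
      rw [hT x k, hT y k, h k le_rfl]
      congr 1
      funext i
      have hi : (⟨i.1, lt_trans i.isLt k.isLt⟩ : Fin d) < k := i.isLt
      exact ih _ hi x y fun j hj => h j (hj.trans hi.le)
  have T2 : MonotoneLast d T := by
    intro k x a b hab
    show T _ k < T _ k
    rw [hT _ k, hT (Function.update x k b) k]
    have e : (fun i : Fin k.1 => T (Function.update x k a) ⟨i.1, lt_trans i.isLt k.isLt⟩) =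
        fun i : Fin k.1 => T (Function.update x k b) ⟨i.1, lt_trans i.isLt k.isLt⟩ := by
      funext i
      have hi : (⟨i.1, lt_trans i.isLt k.isLt⟩ : Fin d) < k := i.isLt
      apply T1
      intro j hj
      have := (hj.trans_lt hi).ne
      rw [Function.update_of_ne this, Function.update_of_ne this]
    rw [e]
    simpa using hfm k _ hab
  refine ⟨hTc, T1, T2, ?_⟩
  intro S hS S1 S2 hm
  haveI : ∀ k, (ν k).IsOpenPosMeasure := by
    intro k
    obtain ⟨p, hp, hpos, he⟩ := hν k
    have : (volume : Measure ℝ) ≪ ν k := by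
      rw [he]
      apply withDensity_absolutelyContinuous'
      · exact (hp.measurable.ennreal_ofReal).aemeasurable
      · exact Filter.Eventually.of_forall fun x => (ENNReal.ofReal_pos.2 (hpos x)).ne'
    exact this.isOpenPosMeasure
  have key : ∀ k, ∀ x, S x k = T x k := by
    intro k
    induction k using WellFoundedLT.induction with
    | ind k ih =>
      intro x
      exact le_antisymm (tri_le (Measure.pi ν) hS hTc S1 S2 T1 T2 hm k ih x)
        (tri_le (Measure.pi ν) hTc hS T1 T2 S1 S2 hm.symm k (fun i hi x => (ih i hi x).symm) x)
  funext x k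
  exact key k x
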